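/- For every δ ∈ (0,1) and β ∈ (0, 1−δ) there exists a constant C > 0 such that the following holds: for all integers k ≥ 1 and d ≥ 1, all reals μ₀ ≥ 1 and κ ≥ 1 with d ≥ C·k⁴·μ₀²·κ², and every γ with 0 < γ < 4√10/(√C·μ₀·k^{3/2}), setting α = (1−β−δ)/(12μ₀k) and ρ = 2k / ((1−β−δ)²/(24μ₀k) − 3γ²μ₀k), one has ρ > 0 and (14/β)·κ·(μ₀k)^{3/2}·√(1.1·e)·(e²ργ²/α)^{αd/2} ≤ γ/(20·√(10k)). -/

import Mathlib

/-- A nonnegative number with `w ^ 2 ≤ e⁻¹` satisfies `(w ^ 2) ^ p ≤ w * exp (1 / 2 - p)`. -/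
theorem sq_rpow_le_mul_exp {w p : ℝ} (hw : 0 < w) (hw2 : w ^ 2 ≤ Real.exp (-1))
    (hp : 1 / 2 ≤ p) : (w ^ 2) ^ p ≤ w * Real.exp (1 / 2 - p) := by
  have hlog : 2 * Real.log w ≤ -1 := by
    have h := Real.log_le_log (by positivity) hw2
    rwa [Real.log_exp, Real.log_pow, Nat.cast_ofNat] at h
  rw [Real.rpow_def_of_pos (by positivity), Real.log_pow, Nat.cast_ofNat]
  nth_rewrite 2 [← Real.exp_log hw]
  rw [← Real.exp_add]
  apply Real.exp_le_exp.mpr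
  nlinarith

/-- `A * t ^ 3 ≤ exp (L * t)` as soon as `L` is at least `6 * A` and `1`. -/
theorem mul_cube_le_exp {A L t : ℝ} (hL : 1 ≤ L) (hA : 6 * A ≤ L) (ht : 0 ≤ t) :
    A * t ^ 3 ≤ Real.exp (L * t) := by
  have h := Real.pow_div_factorial_le_exp (L * t) (by positivity) 3
  have hfac : ((Nat.factorial 3 : ℕ) : ℝ) = 6 := by norm_num [Nat.factorial]
  rw [hfac] at h
  have hL3 : L ≤ L ^ 3 := le_self_pow₀ hL (by norm_num)
  have ht3 : 0 ≤ t ^ 3 := by positivity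
  have h2 : 6 * A * t ^ 3 ≤ L ^ 3 * t ^ 3 :=
    mul_le_mul_of_nonneg_right (hA.trans hL3) ht3
  rw [mul_pow] at h
  linarith

theorem rpow_three_halves_eq_sqrt_pow {x : ℝ} (hx : 0 ≤ x) :
    x ^ ((3 : ℝ) / 2) = Real.sqrt x ^ 3 := by
  rw [Real.sqrt_eq_rpow, ← Real.rpow_natCast, ← Real.rpow_mul hx]
  norm_num

/-- If `κ`, `u`, `s` are at least `1`, the product `κ * u ^ 5 * s ^ 7` is dominated by the cube of
`(s ^ 2) ^ 3 * u ^ 2 * κ ^ 2`. -/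
theorem mul_pow_mul_pow_le_cube {κ u s : ℝ} (hκ : 1 ≤ κ) (hu : 1 ≤ u) (hs : 1 ≤ s) :
    κ * u ^ 5 * s ^ 7 ≤ ((s ^ 2) ^ 3 * u ^ 2 * κ ^ 2) ^ 3 := by
  have h1 : κ ≤ κ ^ 6 := le_self_pow₀ hκ (by norm_num)
  have h2 : u ^ 5 ≤ u ^ 6 := pow_le_pow_right₀ hu (by norm_num)
  have h3 : s ^ 7 ≤ s ^ 18 := pow_le_pow_right₀ hs (by norm_num)
  calc κ * u ^ 5 * s ^ 7 ≤ κ ^ 6 * u ^ 6 * s ^ 18 := by gcongr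
    _ = _ := by ring


theorem stmt_15 (δ β : ℝ) (hδ : δ ∈ Set.Ioo (0 : ℝ) 1)
    (hβ : β ∈ Set.Ioo (0 : ℝ) (1 - δ)) :
    ∃ C : ℝ, 0 < C ∧
      ∀ (k d : ℕ), 1 ≤ k → 1 ≤ d →
      ∀ (μ₀ κ : ℝ), 1 ≤ μ₀ → 1 ≤ κ →
      C * (k : ℝ) ^ 4 * μ₀ ^ 2 * κ ^ 2 ≤ (d : ℝ) →
      ∀ γ : ℝ, 0 < γ →
        γ < 4 * Real.sqrt 10 / (Real.sqrt C * μ₀ * (k : ℝ) ^ ((3 : ℝ) / 2)) →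
        0 < 2 * (k : ℝ) / ((1 - β - δ) ^ 2 / (24 * μ₀ * k) - 3 * γ ^ 2 * μ₀ * k) ∧
        (14 / β) * κ * (μ₀ * k) ^ ((3 : ℝ) / 2) * Real.sqrt (1.1 * Real.exp 1) *
            (Real.exp 1 ^ 2 *
                (2 * (k : ℝ) / ((1 - β - δ) ^ 2 / (24 * μ₀ * k) - 3 * γ ^ 2 * μ₀ * k)) *
                γ ^ 2 / ((1 - β - δ) / (12 * μ₀ * k))) ^
              (((1 - β - δ) / (12 * μ₀ * k)) * d / 2)
          ≤ γ / (20 * Real.sqrt (10 * k)) := by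
  obtain ⟨hδ0, hδ1⟩ := hδ
  obtain ⟨hβ0, hβ1⟩ := hβ
  obtain ⟨c, hc⟩ : ∃ c, c = 1 - β - δ := ⟨_, rfl⟩
  have hc0 : 0 < c := by linarith
  rw [← hc]
  obtain ⟨R, hR⟩ : ∃ R, R = Real.sqrt (1.1 * Real.exp 1) := ⟨_, rfl⟩
  have hR0 : 0 < R := by rw [hR]; positivity
  obtain ⟨T, hT⟩ : ∃ T, T = Real.sqrt 10 := ⟨_, rfl⟩
  have hT0 : 0 < T := by rw [hT]; positivity
  have hT2 : T ^ 2 = 10 := by rw [hT]; exact Real.sq_sqrt (by norm_num)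
  obtain ⟨K, hK⟩ : ∃ K, K = 1152 * Real.exp 1 ^ 2 / c ^ 3 := ⟨_, rfl⟩
  have hK0 : 0 < K := by rw [hK]; positivity
  obtain ⟨Q, hQ⟩ : ∃ Q, Q = Real.sqrt K := ⟨_, rfl⟩
  have hQ0 : 0 < Q := by rw [hQ]; positivity
  have hQ2 : Q ^ 2 = K := by rw [hQ]; exact Real.sq_sqrt hK0.le
  obtain ⟨A, hA⟩ : ∃ A, A = 14 / β * R * (20 * T) * Q := ⟨_, rfl⟩
  have hA0 : 0 < A := by rw [hA]; positivity
  obtain ⟨C, hC⟩ : ∃ C, C = 23040 / c ^ 2 + 160 * K * Real.exp 1 + 24 * (6 * A + 2) / c :=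
    ⟨_, rfl⟩
  have hC1 : 23040 / c ^ 2 ≤ C := by
    have h1 : 0 < 160 * K * Real.exp 1 := by positivity
    have h2 : 0 < 24 * (6 * A + 2) / c := by positivity
    linarith
  have hC2 : 160 * K * Real.exp 1 ≤ C := by
    have h1 : 0 < 23040 / c ^ 2 := by positivity
    have h2 : 0 < 24 * (6 * A + 2) / c := by positivity
    linarith
  have hC3 : 24 * (6 * A + 2) / c ≤ C := by
    have h1 : 0 < 23040 / c ^ 2 := by positivity
    have h2 : 0 < 160 * K * Real.exp 1 := by positivity
    linarith
  have hC0 : 0 < C := lt_of_lt_of_le (by positivity) hC1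
  refine ⟨C, hC0, ?_⟩
  intro k d hk hd μ₀ κ hμ hκ hdC γ hγ0 hγ
  have hk1 : (1 : ℝ) ≤ k := by exact_mod_cast hk
  obtain ⟨x, hx⟩ : ∃ x : ℝ, x = k := ⟨_, rfl⟩
  rw [← hx] at hk1 hdC hγ ⊢
  have hx0 : 0 < x := by linarith
  have hμ0 : 0 < μ₀ := by linarith
  rw [← hT, rpow_three_halves_eq_sqrt_pow hx0.le] at hγ
  rw [rpow_three_halves_eq_sqrt_pow (by positivity), Real.sqrt_mul hμ0.le,
    Real.sqrt_mul (by norm_num : (0 : ℝ) ≤ 10), ← hR, ← hT]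
  obtain ⟨s, hs⟩ : ∃ s, s = Real.sqrt x := ⟨_, rfl⟩
  obtain ⟨u, hu⟩ : ∃ u, u = Real.sqrt μ₀ := ⟨_, rfl⟩
  have hs2 : s ^ 2 = x := by rw [hs]; exact Real.sq_sqrt hx0.le
  have hu2 : u ^ 2 = μ₀ := by rw [hu]; exact Real.sq_sqrt hμ0.le
  have hs1 : 1 ≤ s := by rw [hs]; exact Real.one_le_sqrt.mpr hk1
  have hu1 : 1 ≤ u := by rw [hu]; exact Real.one_le_sqrt.mpr hμ
  have hs0 : 0 < s := by linarith
  have hu0 : 0 < u := by linarith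
  rw [← hs] at hγ
  rw [← hs, ← hu]
  have hγ2 : γ ^ 2 * (C * μ₀ ^ 2 * x ^ 3) ≤ 160 := by
    have hSC : 0 < Real.sqrt C := Real.sqrt_pos.mpr hC0
    rw [lt_div_iff₀ (by positivity)] at hγ
    have h := pow_le_pow_left₀ (by positivity) hγ.le 2
    have e1 : (γ * (Real.sqrt C * μ₀ * s ^ 3)) ^ 2
        = γ ^ 2 * (Real.sqrt C ^ 2 * μ₀ ^ 2 * (s ^ 2) ^ 3) := by ring
    rw [e1, Real.sq_sqrt hC0.le, hs2, mul_pow, hT2] at h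
    linarith
  have hden : c ^ 2 / (48 * μ₀ * x) ≤ c ^ 2 / (24 * μ₀ * x) - 3 * γ ^ 2 * μ₀ * x := by
    have h1 : 3 * γ ^ 2 * μ₀ * x ≤ c ^ 2 / (48 * μ₀ * x) := by
      rw [le_div_iff₀ (by positivity)]
      rw [div_le_iff₀ (by positivity)] at hC1
      have h2 : γ ^ 2 * μ₀ ^ 2 * x ^ 2 * C ≤ 160 := by
        refine le_trans ?_ hγ2
        have h3 : x ^ 2 ≤ x ^ 3 := pow_le_pow_right₀ hk1 (by norm_num)
        calc γ ^ 2 * μ₀ ^ 2 * x ^ 2 * C ≤ γ ^ 2 * μ₀ ^ 2 * x ^ 3 * C := by gcongr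
          _ = _ := by ring
      have h4 : 0 ≤ γ ^ 2 * μ₀ ^ 2 * x ^ 2 := by positivity
      have h5 := mul_le_mul_of_nonneg_left hC1 h4
      have h6 := mul_le_mul_of_nonneg_right h2 (sq_nonneg c)
      linarith
    have h2 : c ^ 2 / (24 * μ₀ * x) = 2 * (c ^ 2 / (48 * μ₀ * x)) := by
      field_simp
      norm_num
    linarith
  obtain ⟨D, hD⟩ : ∃ D, D = c ^ 2 / (24 * μ₀ * x) - 3 * γ ^ 2 * μ₀ * x := ⟨_, rfl⟩
  rw [← hD] at hden ⊢
  have hD0 : 0 < D := lt_of_lt_of_le (by positivity) hden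
  refine ⟨by positivity, ?_⟩
  obtain ⟨w, hw⟩ : ∃ w, w = Q * s ^ 3 * u ^ 2 * γ := ⟨_, rfl⟩
  have hw0 : 0 < w := by rw [hw]; positivity
  have hwsq : w ^ 2 = K * x ^ 3 * μ₀ ^ 2 * γ ^ 2 := by
    rw [hw, ← hQ2, ← hs2, ← hu2]; ring
  have hbase : Real.exp 1 ^ 2 * (2 * x / D) * γ ^ 2 / (c / (12 * μ₀ * x)) ≤ w ^ 2 := by
    calc Real.exp 1 ^ 2 * (2 * x / D) * γ ^ 2 / (c / (12 * μ₀ * x))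
        ≤ Real.exp 1 ^ 2 * (2 * x / (c ^ 2 / (48 * μ₀ * x))) * γ ^ 2 / (c / (12 * μ₀ * x)) := by
          gcongr
      _ = w ^ 2 := by
          rw [hwsq, hK]
          field_simp
          norm_num
  have hw2 : w ^ 2 ≤ Real.exp (-1) := by
    rw [Real.exp_neg, ← one_div, le_div_iff₀ (Real.exp_pos 1), hwsq]
    have h1 : 0 ≤ x ^ 3 * μ₀ ^ 2 * γ ^ 2 := by positivity
    have h2 := mul_le_mul_of_nonneg_left hC2 h1
    linarith
  obtain ⟨t, ht⟩ : ∃ t, t = x ^ 3 * μ₀ * κ ^ 2 := ⟨_, rfl⟩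
  have ht1 : 1 ≤ t := by
    rw [ht]
    exact one_le_mul_of_one_le_of_one_le
      (one_le_mul_of_one_le_of_one_le (one_le_pow₀ hk1) hμ) (one_le_pow₀ hκ)
  obtain ⟨p, hp⟩ : ∃ p, p = c / (12 * μ₀ * x) * d / 2 := ⟨_, rfl⟩
  have hpt : (6 * A + 2) * t ≤ p := by
    calc (6 * A + 2) * t ≤ (c * C / 24) * t := by
          refine mul_le_mul_of_nonneg_right ?_ (by linarith)
          rw [div_le_iff₀ hc0] at hC3
          linarith
      _ = c / (12 * μ₀ * x) * (C * x ^ 4 * μ₀ ^ 2 * κ ^ 2) / 2 := by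
          rw [ht]
          field_simp
          norm_num
      _ ≤ p := by
          rw [hp]
          gcongr
  have hp12 : (6 * A + 1) * t ≤ p - 1 / 2 := by linarith
  have hp0 : 1 / 2 ≤ p := by
    have : 0 ≤ (6 * A + 1) * t := by positivity
    linarith
  rw [← hp]
  have hpow : (Real.exp 1 ^ 2 * (2 * x / D) * γ ^ 2 / (c / (12 * μ₀ * x))) ^ p
      ≤ w * Real.exp (1 / 2 - p) :=
    (Real.rpow_le_rpow (by positivity) hbase (by linarith)).trans
      (sq_rpow_le_mul_exp hw0 hw2 hp0)
  have hmain : A * (κ * u ^ 5 * s ^ 7) * Real.exp (1 / 2 - p) ≤ 1 := by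
    have h1 : A * (κ * u ^ 5 * s ^ 7) ≤ Real.exp (p - 1 / 2) := by
      have h2 := mul_pow_mul_pow_le_cube hκ hu1 hs1
      rw [hs2, hu2, ← ht] at h2
      calc A * (κ * u ^ 5 * s ^ 7) ≤ A * t ^ 3 := by gcongr
        _ ≤ Real.exp ((6 * A + 1) * t) :=
          mul_cube_le_exp (by linarith) (by linarith) (by linarith)
        _ ≤ Real.exp (p - 1 / 2) := Real.exp_le_exp.mpr hp12
    calc A * (κ * u ^ 5 * s ^ 7) * Real.exp (1 / 2 - p)
        ≤ Real.exp (p - 1 / 2) * Real.exp (1 / 2 - p) := by gcongr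
      _ = 1 := by rw [← Real.exp_add]; norm_num
  rw [le_div_iff₀ (by positivity)]
  calc 14 / β * κ * (u * s) ^ 3 * R *
        (Real.exp 1 ^ 2 * (2 * x / D) * γ ^ 2 / (c / (12 * μ₀ * x))) ^ p * (20 * (T * s))
      ≤ 14 / β * κ * (u * s) ^ 3 * R * (w * Real.exp (1 / 2 - p)) * (20 * (T * s)) := by
        gcongr
    _ = γ * (A * (κ * u ^ 5 * s ^ 7) * Real.exp (1 / 2 - p)) := by
        rw [hA, hw]; ring
    _ ≤ γ * 1 := by gcongr
    _ = γ := mul_one γ
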